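/- arXiv:2209.10053 — 3 statements merged into one kernel-verified Lean document; each statement's English description precedes it below -/
import Mathlib

section
/- If Y is a real-valued random variable with E[Y] = 0 and E[e^{λY}] < ∞ for all λ in some interval [0, ε) with ε > 0, then the map r ↦ T_r(Y) is subadditive on [0, ∞): for all r, s ≥ 0, T_{r+s}(Y) ≤ T_r(Y) + T_s(Y), where T_r(Y) := inf_{λ ≥ 0} (r + log E[e^{λY}])/λ. -/
open MeasureTheory

/-- `Tr μ Y r = inf_{λ ≥ 0} (r + log E[e^{λ Y}])/λ`, with the convention that
`log E[e^{λ Y}] = +∞` when `e^{λ Y}` is not integrable, so that such `λ` (as well as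
`λ = 0`, where the expression is `+∞` for `r > 0`) do not contribute to the infimum. -/
noncomputable def Tr {Ω : Type*} [MeasurableSpace Ω] (μ : Measure Ω) (Y : Ω → ℝ) (r : ℝ) : ℝ :=
  sInf {x : ℝ | ∃ l : ℝ, 0 < l ∧ Integrable (fun ω => Real.exp (l * Y ω)) μ ∧
    x = (r + Real.log (∫ ω, Real.exp (l * Y ω) ∂μ)) / l}

section Auxiliary

variable {Ω : Type*} [MeasurableSpace Ω] {μ : Measure Ω} [IsProbabilityMeasure μ] {Y : Ω → ℝ}

theorem log_integral_exp_mul_nonneg (hint : Integrable Y μ) (hmean : ∫ ω, Y ω ∂μ = 0) {l : ℝ}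
    (hl : Integrable (fun ω => Real.exp (l * Y ω)) μ) :
    0 ≤ Real.log (∫ ω, Real.exp (l * Y ω) ∂μ) := by
  apply Real.log_nonneg
  calc (1 : ℝ) = ∫ ω, (l * Y ω + 1) ∂μ := by
        rw [integral_add (hint.const_mul l) (integrable_const 1), integral_const_mul, hmean]
        simp
    _ ≤ ∫ ω, Real.exp (l * Y ω) ∂μ :=
        integral_mono ((hint.const_mul l).add (integrable_const 1)) hl
          fun ω => Real.add_one_le_exp _

theorem Tr_le (hint : Integrable Y μ) (hmean : ∫ ω, Y ω ∂μ = 0) {r : ℝ} (hr : 0 ≤ r) {l : ℝ}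
    (hl : 0 < l) (hexp : Integrable (fun ω => Real.exp (l * Y ω)) μ) :
    Tr μ Y r ≤ (r + Real.log (∫ ω, Real.exp (l * Y ω) ∂μ)) / l := by
  refine csInf_le ⟨0, ?_⟩ ⟨l, hl, hexp, rfl⟩
  rintro x ⟨m, hm, hm_exp, rfl⟩
  have := log_integral_exp_mul_nonneg hint hmean hm_exp
  positivity

theorem Tr_nonneg (hint : Integrable Y μ) (hmean : ∫ ω, Y ω ∂μ = 0) {r : ℝ} (hr : 0 ≤ r) :
    0 ≤ Tr μ Y r := by
  apply Real.sInf_nonneg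
  rintro x ⟨l, hl, hexp, rfl⟩
  have := log_integral_exp_mul_nonneg hint hmean hexp
  positivity

theorem mul_Tr_le_Tr_mul (hint : Integrable Y μ) (hmean : ∫ ω, Y ω ∂μ = 0)
    (hmgf : ∃ l : ℝ, 0 < l ∧ Integrable (fun ω => Real.exp (l * Y ω)) μ)
    {t u : ℝ} (ht₀ : 0 ≤ t) (ht₁ : t ≤ 1) (hu : 0 ≤ u) :
    t * Tr μ Y u ≤ Tr μ Y (t * u) := by
  obtain ⟨l₀, hl₀, hexp₀⟩ := hmgf
  refine le_csInf ⟨_, l₀, hl₀, hexp₀, rfl⟩ ?_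
  rintro x ⟨l, hl, hexp, rfl⟩
  have hlog := log_integral_exp_mul_nonneg hint hmean hexp
  calc t * Tr μ Y u ≤ t * ((u + Real.log (∫ ω, Real.exp (l * Y ω) ∂μ)) / l) :=
        mul_le_mul_of_nonneg_left (Tr_le hint hmean hu hl hexp) ht₀
    _ ≤ (t * u + Real.log (∫ ω, Real.exp (l * Y ω) ∂μ)) / l := by
        rw [← mul_div_assoc, mul_add]
        gcongr
        exact mul_le_of_le_one_left hlog ht₁

end Auxiliary

/-- if `Y` is centered and its moment generating function is finite on some
interval `[0, ε)` with `ε > 0`, then `r ↦ T_r(Y)` is subadditive on `[0, ∞)`: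
`T_{r+s}(Y) ≤ T_r(Y) + T_s(Y)` for all `r, s ≥ 0`. -/
theorem Tr_subadditive {Ω : Type*} [MeasurableSpace Ω] (μ : Measure Ω)
    [IsProbabilityMeasure μ] (Y : Ω → ℝ) (hY : Measurable Y)
    (hint : Integrable Y μ) (hmean : ∫ ω, Y ω ∂μ = 0)
    (hmgf : ∃ ε : ℝ, 0 < ε ∧ ∀ l : ℝ, 0 ≤ l → l < ε →
      Integrable (fun ω => Real.exp (l * Y ω)) μ) :
    ∀ r s : ℝ, 0 ≤ r → 0 ≤ s → Tr μ Y (r + s) ≤ Tr μ Y r + Tr μ Y s := by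
  intro r s hr hs
  rcases (add_nonneg hr hs).eq_or_lt with h | h
  · obtain rfl : r = 0 := by linarith
    obtain rfl : s = 0 := by linarith
    simpa using Tr_nonneg hint hmean (le_refl (0 : ℝ))
  · obtain ⟨ε, hε, hexp⟩ := hmgf
    have hmgf : ∃ l : ℝ, 0 < l ∧ Integrable (fun ω => Real.exp (l * Y ω)) μ :=
      ⟨ε / 2, half_pos hε, hexp _ (half_pos hε).le (half_lt_self hε)⟩
    have h₁ := mul_Tr_le_Tr_mul hint hmean hmgf (div_nonneg hr h.le)
      (div_le_one_of_le₀ (by linarith) h.le) h.le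
    have h₂ := mul_Tr_le_Tr_mul hint hmean hmgf (div_nonneg hs h.le)
      (div_le_one_of_le₀ (by linarith) h.le) h.le
    rw [div_mul_cancel₀ _ h.ne'] at h₁ h₂
    calc Tr μ Y (r + s)
        = r / (r + s) * Tr μ Y (r + s) + s / (r + s) * Tr μ Y (r + s) := by
          rw [← add_mul, ← add_div, div_self h.ne', one_mul]
      _ ≤ Tr μ Y r + Tr μ Y s := add_le_add h₁ h₂
end

section
/- Let ψ : [0, ∞) → [0, ∞) be convex and increasing with ψ(0) = 0, and let Y be a real-valued random variable with E[Y] = 0 and E[ψ(|Y|)] ≤ 1 (i.e., ‖Y‖_ψ ≤ 1 in the ψ-Orlicz norm). Then for every λ ≥ 0, E[e^{λY}] ≤ 1 + ∫_0^∞ 2λ (e^{λt} − 1)/(ψ(t) + 1) dt. Consequently, inf_{λ ≥ 0} (r + log E[e^{λY}])/λ ≤ inf_{λ ≥ 0} (r + log(1 + ∫_0^∞ 2λ (e^{λt} − 1)/(ψ(t) + 1) dt))/λ for every r ≥ 0. -/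
open MeasureTheory
open scoped ENNReal

/-- Exponential moment bound through the layer-cake formula, for a centered variable. -/
lemma lintegral_exp_mul_le_one_add {Ω : Type*} [MeasurableSpace Ω] (μ : Measure Ω)
    [IsProbabilityMeasure μ] (Y : Ω → ℝ) (hY : Measurable Y) (hint : Integrable Y μ)
    (hmean : ∫ ω, Y ω ∂μ = 0) {l : ℝ} (hl : 0 ≤ l) :
    ∫⁻ ω, ENNReal.ofReal (Real.exp (l * Y ω)) ∂μ ≤
      1 + ∫⁻ t in Set.Ioi (0 : ℝ),
        μ {ω | t ≤ |Y ω|} * ENNReal.ofReal (l * (Real.exp (l * t) - 1)) := by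
  have hprim : ∀ y : ℝ, ∫ t in (0 : ℝ)..y, l * (Real.exp (l * t) - 1) =
      Real.exp (l * y) - 1 - l * y := by
    intro y
    rw [intervalIntegral.integral_eq_sub_of_hasDerivAt
      (f := fun t => Real.exp (l * t) - 1 - l * t)]
    · simp
    · intro t _
      have h : HasDerivAt (fun t => l * t) l t := by
        simpa using (hasDerivAt_id t).const_mul l
      exact ((h.exp.sub_const 1).sub h).congr_deriv (by ring)
    · exact Continuous.intervalIntegrable (by fun_prop) _ _
  rw [← lintegral_comp_eq_lintegral_meas_le_mul μ (f := fun ω => |Y ω|)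
    (g := fun t => l * (Real.exp (l * t) - 1)) (ae_of_all _ fun ω => abs_nonneg _)
    hY.abs.aemeasurable
    (fun t _ => Continuous.intervalIntegrable (by fun_prop) _ _)
    ((ae_restrict_iff' measurableSet_Ioi).2 (ae_of_all _ fun t (ht : 0 < t) =>
      mul_nonneg hl (sub_nonneg.2 (Real.one_le_exp (by positivity)))))]
  simp_rw [hprim]
  by_cases htop : ∫⁻ ω, ENNReal.ofReal (Real.exp (l * |Y ω|) - 1 - l * |Y ω|) ∂μ = ⊤
  · simp [htop]
  have hnn : ∀ y : ℝ, 0 ≤ Real.exp y - 1 - y := fun y => by linarith [Real.add_one_le_exp y]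
  have hR : Integrable (fun ω => Real.exp (l * |Y ω|) - 1 - l * |Y ω|) μ :=
    (lintegral_ofReal_ne_top_iff_integrable (by fun_prop)
      (ae_of_all _ fun ω => hnn _)).1 htop
  have hdom : ∀ ω, Real.exp (l * Y ω) ≤
      1 + l * Y ω + (Real.exp (l * |Y ω|) - 1 - l * |Y ω|) := by
    intro ω
    rcases abs_cases (Y ω) with ⟨h, _⟩ | ⟨h, h0⟩
    · rw [h]; linarith
    · rw [h]
      have h1 : 0 ≤ -(l * Y ω) := by nlinarith
      have h2 := Real.self_le_sinh_iff.2 h1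
      rw [Real.sinh_eq, neg_neg] at h2
      rw [mul_neg]
      linarith
  have hlY : Integrable (fun ω => 1 + l * Y ω) μ :=
    (integrable_const 1).add (hint.const_mul l)
  calc ∫⁻ ω, ENNReal.ofReal (Real.exp (l * Y ω)) ∂μ
      ≤ ∫⁻ ω, ENNReal.ofReal (1 + l * Y ω + (Real.exp (l * |Y ω|) - 1 - l * |Y ω|)) ∂μ :=
        lintegral_mono fun ω => ENNReal.ofReal_le_ofReal (hdom ω)
    _ = ENNReal.ofReal
          (∫ ω, (1 + l * Y ω + (Real.exp (l * |Y ω|) - 1 - l * |Y ω|)) ∂μ) :=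
        (ofReal_integral_eq_lintegral_ofReal (hlY.add hR)
          (ae_of_all _ fun ω => (Real.exp_pos _).le.trans (hdom ω))).symm
    _ = ENNReal.ofReal (1 + ∫ ω, (Real.exp (l * |Y ω|) - 1 - l * |Y ω|) ∂μ) := by
        rw [integral_add hlY hR, integral_add (integrable_const 1) (hint.const_mul l),
          integral_const_mul, hmean]
        simp
    _ = _ := by
        rw [ENNReal.ofReal_add zero_le_one (integral_nonneg fun ω => hnn _),
          ENNReal.ofReal_one,
          ofReal_integral_eq_lintegral_ofReal hR (ae_of_all _ fun ω => hnn _)]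

/-- Markov's inequality on the unit Orlicz ball. -/
lemma measure_le_abs_le_of_integral_comp_abs_le_one {Ω : Type*} [MeasurableSpace Ω]
    (μ : Measure Ω) [IsProbabilityMeasure μ] {ψ : ℝ → ℝ} (hmono : MonotoneOn ψ (Set.Ici 0))
    (hψnn : ∀ t : ℝ, 0 ≤ t → 0 ≤ ψ t) {Y : Ω → ℝ}
    (hψint : Integrable (fun ω => ψ |Y ω|) μ) (hψle : ∫ ω, ψ |Y ω| ∂μ ≤ 1)
    {t : ℝ} (ht : 0 ≤ t) :
    μ {ω | t ≤ |Y ω|} ≤ ENNReal.ofReal (2 / (ψ t + 1)) := by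
  have hpos : 0 < ψ t + 1 := by linarith [hψnn t ht]
  have hm := mul_meas_ge_le_integral_of_nonneg (μ := μ) (f := fun ω => ψ |Y ω| + 1)
    (ae_of_all _ fun ω => add_nonneg (hψnn _ (abs_nonneg _)) zero_le_one)
    (hψint.add (integrable_const 1)) (ψ t + 1)
  rw [integral_add hψint (integrable_const 1)] at hm
  simp only [integral_const, probReal_univ, smul_eq_mul, mul_one] at hm
  calc μ {ω | t ≤ |Y ω|} ≤ μ {ω | ψ t + 1 ≤ ψ |Y ω| + 1} :=
        measure_mono fun ω (hω : t ≤ |Y ω|) =>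
          add_le_add_left (hmono ht (abs_nonneg (Y ω)) hω) 1
    _ = ENNReal.ofReal (μ.real {ω | ψ t + 1 ≤ ψ |Y ω| + 1}) := (ofReal_measureReal).symm
    _ ≤ _ := by
        apply ENNReal.ofReal_le_ofReal
        rw [le_div_iff₀ hpos]
        linarith

/-- The values defining `Tr` are nonnegative, so each of them bounds `Tr` from above. -/
lemma Tr_le_of_integrable_exp {Ω : Type*} [MeasurableSpace Ω] (μ : Measure Ω)
    [IsProbabilityMeasure μ] {Y : Ω → ℝ} (hint : Integrable Y μ) (hmean : ∫ ω, Y ω ∂μ = 0)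
    {r l : ℝ} (hr : 0 ≤ r) (hl : 0 < l) (hexp : Integrable (fun ω => Real.exp (l * Y ω)) μ) :
    Tr μ Y r ≤ (r + Real.log (∫ ω, Real.exp (l * Y ω) ∂μ)) / l := by
  refine csInf_le ⟨0, ?_⟩ ⟨l, hl, hexp, rfl⟩
  rintro x ⟨k, hk, hkexp, rfl⟩
  have h1 : (1 : ℝ) ≤ ∫ ω, Real.exp (k * Y ω) ∂μ := by
    have h := integral_mono ((hint.const_mul k).add (integrable_const 1)) hkexp
      fun ω => Real.add_one_le_exp (k * Y ω)
    simp only [Pi.add_apply] at h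
    rw [integral_add (hint.const_mul k) (integrable_const 1), integral_const_mul, hmean] at h
    simpa using h
  exact div_nonneg (add_nonneg hr (Real.log_nonneg h1)) hk.le

/-- for `ψ : [0,∞) → [0,∞)` convex, increasing, `ψ(0) = 0`, and a centered
random variable `Y` with `E[ψ(|Y|)] ≤ 1` (unit ψ-Orlicz ball), one has for every `λ ≥ 0`
`E[e^{λY}] ≤ 1 + ∫_0^∞ 2λ(e^{λt} - 1)/(ψ(t) + 1) dt` (an inequality in `[0,∞]`, trivial
when the integral is infinite), and consequently, for every `r ≥ 0`,
`inf_{λ ≥ 0} (r + log E[e^{λY}])/λ ≤ inf_{λ ≥ 0} (r + log(1 + ∫_0^∞ 2λ(e^{λt}-1)/(ψ(t)+1) dt))/λ`. -/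
theorem orlicz_mgf_bound {Ω : Type*} [MeasurableSpace Ω] (μ : Measure Ω)
    [IsProbabilityMeasure μ]
    (ψ : ℝ → ℝ) (hconv : ConvexOn ℝ (Set.Ici 0) ψ) (hmono : MonotoneOn ψ (Set.Ici 0))
    (hψ0 : ψ 0 = 0) (hψnn : ∀ t : ℝ, 0 ≤ t → 0 ≤ ψ t)
    (Y : Ω → ℝ) (hY : Measurable Y) (hint : Integrable Y μ) (hmean : ∫ ω, Y ω ∂μ = 0)
    (hψint : Integrable (fun ω => ψ |Y ω|) μ) (hψle : ∫ ω, ψ |Y ω| ∂μ ≤ 1) :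
    (∀ l : ℝ, 0 ≤ l →
      ∫⁻ ω, ENNReal.ofReal (Real.exp (l * Y ω)) ∂μ ≤
        1 + ∫⁻ t in Set.Ioi (0 : ℝ),
          ENNReal.ofReal (2 * l * (Real.exp (l * t) - 1) / (ψ t + 1))) ∧
    (∀ r : ℝ, 0 ≤ r → ∀ l : ℝ, 0 < l →
      (∫⁻ t in Set.Ioi (0 : ℝ),
          ENNReal.ofReal (2 * l * (Real.exp (l * t) - 1) / (ψ t + 1))) ≠ ⊤ →
      Tr μ Y r ≤
        (r + Real.log (1 + (∫⁻ t in Set.Ioi (0 : ℝ),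
          ENNReal.ofReal (2 * l * (Real.exp (l * t) - 1) / (ψ t + 1))).toReal)) / l) := by
  have hbound : ∀ l : ℝ, 0 ≤ l →
      ∫⁻ ω, ENNReal.ofReal (Real.exp (l * Y ω)) ∂μ ≤
        1 + ∫⁻ t in Set.Ioi (0 : ℝ),
          ENNReal.ofReal (2 * l * (Real.exp (l * t) - 1) / (ψ t + 1)) := by
    intro l hl
    refine (lintegral_exp_mul_le_one_add μ Y hY hint hmean hl).trans ?_
    gcongr 1 + ?_
    refine setLIntegral_mono' measurableSet_Ioi fun t (ht : 0 < t) => ?_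
    have hpos := hψnn t ht.le
    calc μ {ω | t ≤ |Y ω|} * ENNReal.ofReal (l * (Real.exp (l * t) - 1))
        ≤ ENNReal.ofReal (2 / (ψ t + 1)) * ENNReal.ofReal (l * (Real.exp (l * t) - 1)) := by
          gcongr
          exact measure_le_abs_le_of_integral_comp_abs_le_one μ hmono hψnn hψint hψle ht.le
      _ = ENNReal.ofReal (2 * l * (Real.exp (l * t) - 1) / (ψ t + 1)) := by
          rw [← ENNReal.ofReal_mul (by positivity)]
          ring_nf
  refine ⟨hbound, fun r hr l hl hfin => ?_⟩
  have hle := hbound l hl.le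
  have hsum := ENNReal.add_ne_top.2 ⟨ENNReal.one_ne_top, hfin⟩
  have hexp : Integrable (fun ω => Real.exp (l * Y ω)) μ :=
    (lintegral_ofReal_ne_top_iff_integrable (by fun_prop)
      (ae_of_all _ fun ω => (Real.exp_pos _).le)).1 (ne_top_of_le_ne_top hsum hle)
  refine (Tr_le_of_integrable_exp μ hint hmean hr hl hexp).trans ?_
  have hreal := ENNReal.toReal_mono hsum hle
  rw [ENNReal.toReal_add ENNReal.one_ne_top hfin, ENNReal.toReal_one,
    ← integral_eq_lintegral_of_nonneg_ae (ae_of_all _ fun ω => (Real.exp_pos _).le)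
      hexp.aestronglyMeasurable] at hreal
  have hposint := integral_exp_pos hexp
  gcongr
end

section
/- For L > 0, let φ : [0, ∞) → [0, ∞) be given by φ(t) = (√(1 + 2Lt) − 1)²/L². Then its convex conjugate φ*(λ) := sup_{t ≥ 0} (λt − φ(t)) satisfies: φ*(λ) = λ²/(4(1 − Lλ/2)) for λ ∈ [0, 2/L), and φ*(λ) = +∞ for λ > 2/L. In particular, e^{φ*(λ)} − 1 ≥ φ*(λ) ≥ λ²/4 for all λ ≥ 0. -/
open scoped ENNReal

/-- The convex conjugate `φ*(λ) = sup_{t ≥ 0} (λ t - φ(t))`, valued in `[0, ∞]`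
(the supremum is nonnegative because `t = 0` gives the value `0`). -/
noncomputable def phistar (φ : ℝ → ℝ) (l : ℝ) : ℝ≥0∞ :=
  ⨆ (t : ℝ) (_ : 0 ≤ t), ENNReal.ofReal (l * t - φ t)

/-- The substitution `t = u + L u² / 2` turns the conjugate of the Bernstein–Orlicz function into
the supremum of a quadratic function of `u`. -/
theorem phistar_bernstein_eq_iSup {L : ℝ} (hL : 0 < L) (l : ℝ) :
    phistar (fun t => (Real.sqrt (1 + 2 * L * t) - 1) ^ 2 / L ^ 2) l =
      ⨆ (u : ℝ) (_ : 0 ≤ u), ENNReal.ofReal (l * u - (1 - L * l / 2) * u ^ 2) := by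
  unfold phistar
  apply le_antisymm
  · refine iSup₂_le fun t ht => ?_
    have hnonneg : 0 ≤ 2 * L * t := by positivity
    have hsq : Real.sqrt (1 + 2 * L * t) ^ 2 = 1 + 2 * L * t := Real.sq_sqrt (by linarith)
    have hone : 1 ≤ Real.sqrt (1 + 2 * L * t) := Real.one_le_sqrt.mpr (by linarith)
    refine le_iSup₂_of_le ((Real.sqrt (1 + 2 * L * t) - 1) / L)
      (div_nonneg (by linarith) hL.le) (le_of_eq ?_)
    congr 1
    beta_reduce
    generalize Real.sqrt (1 + 2 * L * t) = s at *
    have ht' : t = (s ^ 2 - 1) / (2 * L) := by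
      rw [hsq]
      field_simp
      ring
    rw [ht']
    field_simp
    ring
  · refine iSup₂_le fun u hu => ?_
    refine le_iSup₂_of_le (u + L * u ^ 2 / 2) (by positivity) (le_of_eq ?_)
    have hsqrt : Real.sqrt (1 + 2 * L * (u + L * u ^ 2 / 2)) = 1 + L * u := by
      rw [show 1 + 2 * L * (u + L * u ^ 2 / 2) = (1 + L * u) ^ 2 by ring]
      exact Real.sqrt_sq (by positivity)
    congr 1
    simp only [hsqrt]
    field_simp
    ring

/-- for the Bernstein–Orlicz function `φ(t) = (√(1 + 2Lt) - 1)²/L²`,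
the convex conjugate satisfies `φ*(λ) = λ²/(4(1 - Lλ/2))` for `λ ∈ [0, 2/L)` and
`φ*(λ) = +∞` for `λ > 2/L`; in particular `e^{φ*(λ)} - 1 ≥ φ*(λ) ≥ λ²/4` for all
`λ ≥ 0`. -/
theorem bernstein_conjugate (L : ℝ) (hL : 0 < L) :
    (∀ l : ℝ, 0 ≤ l → l < 2 / L →
      phistar (fun t => (Real.sqrt (1 + 2 * L * t) - 1) ^ 2 / L ^ 2) l =
        ENNReal.ofReal (l ^ 2 / (4 * (1 - L * l / 2)))) ∧
    (∀ l : ℝ, 2 / L < l →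
      phistar (fun t => (Real.sqrt (1 + 2 * L * t) - 1) ^ 2 / L ^ 2) l = ⊤) ∧
    (∀ l : ℝ, 0 ≤ l →
      ENNReal.ofReal (l ^ 2 / 4) ≤
        phistar (fun t => (Real.sqrt (1 + 2 * L * t) - 1) ^ 2 / L ^ 2) l) ∧
    (∀ l : ℝ, 0 ≤ l →
      phistar (fun t => (Real.sqrt (1 + 2 * L * t) - 1) ^ 2 / L ^ 2) l ≠ ⊤ →
      (phistar (fun t => (Real.sqrt (1 + 2 * L * t) - 1) ^ 2 / L ^ 2) l).toReal ≤
        Real.exp ((phistar (fun t => (Real.sqrt (1 + 2 * L * t) - 1) ^ 2 / L ^ 2) l).toReal)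
          - 1) := by
  simp only [phistar_bernstein_eq_iSup hL]
  refine ⟨fun l hl hlt => ?_, fun l hlt => ?_, fun l hl => ?_, fun l _ _ => ?_⟩
  · have hc : 0 < 1 - L * l / 2 := by
      rw [lt_div_iff₀ hL] at hlt
      linarith
    generalize 1 - L * l / 2 = c at hc
    apply le_antisymm
    · refine iSup₂_le fun u _ => ENNReal.ofReal_le_ofReal ?_
      rw [le_div_iff₀ (by positivity)]
      nlinarith [sq_nonneg (l - 2 * c * u)]
    · refine le_iSup₂_of_le (l / (2 * c)) (by positivity) (ENNReal.ofReal_le_ofReal (le_of_eq ?_))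
      field_simp
      ring
  · have hl : 0 < l := lt_trans (by positivity) hlt
    have hc : 1 - L * l / 2 < 0 := by
      rw [div_lt_iff₀ hL] at hlt
      linarith
    refine ENNReal.eq_top_of_forall_nnreal_le fun r => ?_
    refine le_iSup₂_of_le (r / l) (by positivity) ?_
    rw [← ENNReal.ofReal_coe_nnreal]
    apply ENNReal.ofReal_le_ofReal
    rw [mul_div_cancel₀ _ hl.ne']
    nlinarith [mul_nonneg (neg_nonneg.mpr hc.le) (sq_nonneg ((r : ℝ) / l))]
  · refine le_iSup₂_of_le (l / 2) (by positivity) (ENNReal.ofReal_le_ofReal ?_)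
    have hcube : 0 ≤ L * l ^ 3 := by positivity
    nlinarith
  · exact le_sub_iff_add_le.mpr (Real.add_one_le_exp _)
end
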